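/- Let N be a positive integer, 𝔄 = [𝔞₁,…,𝔞ₙ] a tuple of elements of 𝔈, and F ∈ ℤ[X₁,…,Xₙ]. Then T_{𝔄,F} is invariant under Γ₀(N): for every A = (a b; c d) ∈ Γ₀(N) and every τ in the upper half-plane, T_{𝔄,F}((aτ+b)/(cτ+d)) = T_{𝔄,F}(τ). -/

import Mathlib

open scoped MatrixGroups
open Complex

/-- The Weierstrass ℘-function of the lattice `L_τ = ℤ + ℤτ`. -/
noncomputable def wp (τ z : ℂ) : ℂ :=
  1 / z ^ 2 + ∑' p : {p : ℤ × ℤ // p ≠ 0},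
    (1 / (z - ((p.1.1 : ℂ) + (p.1.2 : ℂ) * τ)) ^ 2 - 1 / ((p.1.1 : ℂ) + (p.1.2 : ℂ) * τ) ^ 2)

/-- The function `W_𝔞` for the triple `𝔞 = [a₁,a₂,a₃]`. -/
noncomputable def Wfun (N : ℕ) (a₁ a₂ a₃ : ℤ) (τ : ℂ) : ℂ :=
  (wp τ ((a₁ : ℂ) / N) - wp τ ((a₃ : ℂ) / N)) / (wp τ ((a₂ : ℂ) / N) - wp τ ((a₃ : ℂ) / N))

/-- Möbius action of an integral 2×2 matrix on ℂ. -/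
noncomputable def moebius (A : Matrix (Fin 2) (Fin 2) ℤ) (τ : ℂ) : ℂ :=
  ((A 0 0 : ℂ) * τ + (A 0 1 : ℂ)) / ((A 1 0 : ℂ) * τ + (A 1 1 : ℂ))

/-- `𝔖_N = (ℤ/Nℤ)ˣ/{±1}`. -/
abbrev SNgroup (N : ℕ) := (ZMod N)ˣ ⧸ (Subgroup.closure ({-1} : Set (ZMod N)ˣ))

/-- The triple `𝔞 = [a₁,a₂,a₃]` is in `𝔈`. -/
def memE (N : ℕ) (a : ℤ × ℤ × ℤ) : Prop :=
  0 < a.1 ∧ 0 < a.2.1 ∧ 0 < a.2.2 ∧ 2 * a.1 ≤ (N : ℤ) ∧ 2 * a.2.1 ≤ (N : ℤ) ∧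
    2 * a.2.2 ≤ (N : ℤ) ∧ a.1 ≠ a.2.1 ∧ a.1 ≠ a.2.2 ∧ a.2.1 ≠ a.2.2

def memE1 (N : ℕ) (a : ℤ × ℤ × ℤ) : Prop :=
  memE N a ∧ IsCoprime (a.1 * a.2.1 * a.2.2) (N : ℤ)

def memE2 (N : ℕ) (a : ℤ × ℤ × ℤ) : Prop :=
  memE1 N a ∧ IsCoprime (a.1 - a.2.2) (N : ℤ) ∧ IsCoprime (a.1 + a.2.2) (N : ℤ) ∧
    IsCoprime (a.2.1 - a.2.2) (N : ℤ) ∧ IsCoprime (a.2.1 + a.2.2) (N : ℤ)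

/-- `M` is a lift to `Γ₀(N)` of `diag(λ⁻¹, λ)` for the class `s = λ ∈ 𝔖_N`. -/
def IsDiagLift (N : ℕ) (M : SL(2, ℤ)) (s : SNgroup N) : Prop :=
  ∃ u : (ZMod N)ˣ, (QuotientGroup.mk u : SNgroup N) = s ∧
    ((M 0 0 : ℤ) : ZMod N) = ((u⁻¹ : (ZMod N)ˣ) : ZMod N) ∧
    ((M 0 1 : ℤ) : ZMod N) = 0 ∧ ((M 1 0 : ℤ) : ZMod N) = 0 ∧
    ((M 1 1 : ℤ) : ZMod N) = (u : ZMod N)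

/-- The function `T_{𝔄,F}`. -/
noncomputable def Tfun (N : ℕ) {n : ℕ} (A : Fin n → ℤ × ℤ × ℤ)
    (F : MvPolynomial (Fin n) ℤ) (M : SNgroup N → SL(2, ℤ)) (τ : ℂ) : ℂ :=
  ∑ᶠ s : SNgroup N, MvPolynomial.aeval
    (fun i => Wfun N (A i).1 (A i).2.1 (A i).2.2 (moebius ((M s : SL(2, ℤ)) : Matrix (Fin 2) (Fin 2) ℤ) τ)) F

/-- The matrix `B(t,u,v,k)`. -/
def Bmat (t : ℕ) (u v k : ℤ) : Matrix (Fin 2) (Fin 2) ℤ :=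
  !![u, (u * v - 1) / (t : ℤ) + u * k; (t : ℤ), v + (t : ℤ) * k]

/-- `{a}` : the representative of `±a mod N` in `(0, N/2]` (paper's `{·}`). -/
def red (N : ℕ) (a : ℤ) : ℤ :=
  if 2 * (a % (N : ℤ)) ≤ (N : ℤ) then a % (N : ℤ) else (N : ℤ) - a % (N : ℤ)

/-- `μ(a) ∈ {±1}` with `a ≡ μ(a){a} mod N`. -/
def muSign (N : ℕ) (a : ℤ) : ℤ :=
  if 2 * (a % (N : ℤ)) ≤ (N : ℤ) then 1 else -1

/-- `φ_s(τ) = (2πi)⁻²℘(s/N; L_τ) − 1/12`. -/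
noncomputable def phiFun (N : ℕ) (s : ℤ) (τ : ℂ) : ℂ :=
  (1 / (2 * (Real.pi : ℂ) * Complex.I) ^ 2) * wp τ ((s : ℂ) / N) - 1 / 12

/-- `f[A]₂` : weight-2 slash of `φ_s`. -/
noncomputable def phiSlash (N : ℕ) (s : ℤ) (A : Matrix (Fin 2) (Fin 2) ℤ) (τ : ℂ) : ℂ :=
  phiFun N s (moebius A τ) * ((A 1 0 : ℂ) * τ + (A 1 1 : ℂ)) ^ (-2 : ℤ)

/-- `q = e^{2πiτ/N}`. -/
noncomputable def qq (N : ℕ) (τ : ℂ) : ℂ :=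
  Complex.exp (2 * (Real.pi : ℂ) * Complex.I * τ / N)

/-- `ζ = e^{2πi/N}`. -/
noncomputable def zetaN (N : ℕ) : ℂ :=
  Complex.exp (2 * (Real.pi : ℂ) * Complex.I / N)

/-- `θ_{a,b} = ζ^a(1−ζ^{b−a})(1−ζ^{b+a})/((1−ζ^a)²(1−ζ^b)²)`. -/
noncomputable def theta (ζ : ℂ) (a b : ℤ) : ℂ :=
  ζ ^ a * (1 - ζ ^ (b - a)) * (1 - ζ ^ (b + a)) / ((1 - ζ ^ a) ^ 2 * (1 - ζ ^ b) ^ 2)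

/-- The pair of periods `1, τ`, for `τ` in the upper half-plane. -/
noncomputable def upperHalfPlanePeriodPair (τ : ℂ) (hτ : 0 < τ.im) : PeriodPair where
  ω₁ := 1
  ω₂ := τ
  indep := by
    rw [LinearIndependent.pair_iff]
    intro s t h
    have him := congrArg Complex.im h
    have hre := congrArg Complex.re h
    simp at him hre
    have ht : t = 0 := him.resolve_right hτ.ne'
    simpa [ht] using hre

lemma hasSum_prod_weierstrassP (τ : ℂ) (hτ : 0 < τ.im) (z : ℂ) :
    HasSum (fun p : ℤ × ℤ ↦ 1 / (z - ((p.1 : ℂ) + (p.2 : ℂ) * τ)) ^ 2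
      - 1 / ((p.1 : ℂ) + (p.2 : ℂ) * τ) ^ 2)
      ((upperHalfPlanePeriodPair τ hτ).weierstrassP z) := by
  set L := upperHalfPlanePeriodPair τ hτ with hL
  have h := (L.latticeEquivProd.symm.toEquiv.hasSum_iff).2 (L.hasSum_weierstrassP z)
  refine h.congr_fun ?_
  intro p
  have hp : ((L.latticeEquivProd.symm p : L.lattice) : ℂ) = p.1 + p.2 * τ := by
    rw [L.latticeEquiv_symm_apply]
    simp [hL, upperHalfPlanePeriodPair]
  simp [hp]

lemma wp_eq_weierstrassP (τ : ℂ) (hτ : 0 < τ.im) (z : ℂ) :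
    wp τ z = (upperHalfPlanePeriodPair τ hτ).weierstrassP z := by
  have h := hasSum_prod_weierstrassP τ hτ z
  rw [← h.tsum_eq, ← h.summable.tsum_subtype_add_tsum_subtype_compl {0}, wp]
  congr 1
  rw [tsum_singleton (0 : ℤ × ℤ) fun p : ℤ × ℤ ↦
    1 / (z - ((p.1 : ℂ) + (p.2 : ℂ) * τ)) ^ 2 - 1 / ((p.1 : ℂ) + (p.2 : ℂ) * τ) ^ 2]
  simp

lemma wp_eq_tsum (τ : ℂ) (hτ : 0 < τ.im) (z : ℂ) :
    wp τ z = ∑' p : ℤ × ℤ, (1 / (z - ((p.1 : ℂ) + (p.2 : ℂ) * τ)) ^ 2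
      - 1 / ((p.1 : ℂ) + (p.2 : ℂ) * τ) ^ 2) := by
  rw [wp_eq_weierstrassP τ hτ, (hasSum_prod_weierstrassP τ hτ z).tsum_eq]

lemma wp_neg (τ : ℂ) (hτ : 0 < τ.im) (z : ℂ) : wp τ (-z) = wp τ z := by
  simp [wp_eq_weierstrassP τ hτ]

lemma wp_add_lattice (τ : ℂ) (hτ : 0 < τ.im) (z : ℂ) (m n : ℤ) :
    wp τ (z + (m + n * τ)) = wp τ z := by
  rw [wp_eq_weierstrassP τ hτ, wp_eq_weierstrassP τ hτ]
  refine (upperHalfPlanePeriodPair τ hτ).weierstrassP_add_coe z ⟨_, ?_⟩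
  exact PeriodPair.mem_lattice.2 ⟨m, n, by simp [upperHalfPlanePeriodPair]⟩

lemma moebius_im_pos (g : SL(2, ℤ)) (τ : ℂ) (hτ : 0 < τ.im) : 0 < (moebius g τ).im := by
  have h := (g • (⟨τ, hτ⟩ : UpperHalfPlane)).im_pos
  rw [← UpperHalfPlane.coe_im, UpperHalfPlane.coe_specialLinearGroup_apply] at h
  simpa [moebius] using h

lemma moebius_denom_ne_zero (g : SL(2, ℤ)) (τ : ℂ) (hτ : 0 < τ.im) :
    (g 1 0 : ℂ) * τ + (g 1 1 : ℂ) ≠ 0 := by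
  simpa [UpperHalfPlane.denom] using UpperHalfPlane.denom_ne_zero
    (g : GL (Fin 2) ℝ) (⟨τ, hτ⟩ : UpperHalfPlane)

lemma moebius_mul (g h : SL(2, ℤ)) (τ : ℂ) (hτ : 0 < τ.im) :
    moebius (g * h : SL(2, ℤ)) τ = moebius g (moebius h τ) := by
  have hj := moebius_denom_ne_zero h τ hτ
  simp only [moebius, Matrix.SpecialLinearGroup.coe_mul, Matrix.mul_apply, Fin.sum_univ_two]
  rw [← mul_div_mul_right _ ((g 1 0 : ℂ) * _ + _) hj]
  congr 1
  all_goals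
    push_cast
    field_simp
    ring

/-- The effect on lattice coordinates of passing from `τ` to `g • τ`. -/
def latticeCoordEquiv (g : SL(2, ℤ)) : ℤ × ℤ ≃ ℤ × ℤ where
  toFun p := (p.1 * g 1 1 + p.2 * g 0 1, p.1 * g 1 0 + p.2 * g 0 0)
  invFun p := (g 0 0 * p.1 - g 0 1 * p.2, - g 1 0 * p.1 + g 1 1 * p.2)
  left_inv p := by
    have h := g.det_coe
    rw [Matrix.det_fin_two] at h
    ext
    · linear_combination p.1 * h
    · linear_combination p.2 * h
  right_inv p := by
    have h := g.det_coe
    rw [Matrix.det_fin_two] at h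
    ext
    · linear_combination p.1 * h
    · linear_combination p.2 * h

lemma wp_moebius (g : SL(2, ℤ)) (τ : ℂ) (hτ : 0 < τ.im) (z : ℂ) :
    wp (moebius g τ) z = ((g 1 0 : ℂ) * τ + (g 1 1 : ℂ)) ^ 2 *
      wp τ (((g 1 0 : ℂ) * τ + (g 1 1 : ℂ)) * z) := by
  have hj := moebius_denom_ne_zero g τ hτ
  rw [wp_eq_tsum _ (moebius_im_pos g τ hτ), wp_eq_tsum τ hτ, ← tsum_mul_left]
  refine Eq.trans ?_ ((latticeCoordEquiv g).tsum_eq _)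
  refine tsum_congr fun p ↦ ?_
  set j := (g 1 0 : ℂ) * τ + (g 1 1 : ℂ) with hjdef
  set w := (((latticeCoordEquiv g p).1 : ℤ) : ℂ) + ((latticeCoordEquiv g p).2 : ℂ) * τ with hw
  have hm : (p.1 : ℂ) + (p.2 : ℂ) * moebius g τ = w / j := by
    rw [eq_div_iff hj, moebius, add_mul, mul_assoc, div_mul_cancel₀ _ hj, hw, hjdef]
    simp only [latticeCoordEquiv, Equiv.coe_fn_mk]
    push_cast
    ring
  have hz : z - w / j = (j * z - w) / j := by field_simp
  rw [hm, hz, div_pow, div_pow, one_div_div, one_div_div]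
  ring

lemma wp_div_congr (N : ℕ) (hN : 0 < N) (τ : ℂ) (hτ : 0 < τ.im) (k l : ℤ)
    (h : (k : ZMod N) = l) : wp τ ((k : ℂ) / N) = wp τ ((l : ℂ) / N) := by
  obtain ⟨m, hm⟩ := (ZMod.intCast_eq_intCast_iff_dvd_sub l k N).1 h.symm
  have hN' : (N : ℂ) ≠ 0 := by exact_mod_cast hN.ne'
  have hk : (k : ℂ) / N = (l : ℂ) / N + ((m : ℤ) + (0 : ℤ) * τ) := by
    have : (k : ℂ) = l + N * m := by
      rw [sub_eq_iff_eq_add'] at hm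
      exact_mod_cast hm
    rw [this]
    field_simp
    simp
  rw [hk, wp_add_lattice τ hτ]

lemma wp_div_congr_neg (N : ℕ) (hN : 0 < N) (τ : ℂ) (hτ : 0 < τ.im) (k l : ℤ)
    (h : (k : ZMod N) = -l) : wp τ ((k : ℂ) / N) = wp τ ((l : ℂ) / N) := by
  rw [wp_div_congr N hN τ hτ k (-l) (by simpa using h), ← wp_neg τ hτ]
  congr 1
  push_cast
  ring

lemma wp_moebius_div (N : ℕ) (hN : 0 < N) (g : SL(2, ℤ)) (hg : g ∈ CongruenceSubgroup.Gamma0 N)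
    (τ : ℂ) (hτ : 0 < τ.im) (a : ℤ) :
    wp (moebius g τ) ((a : ℂ) / N) = ((g 1 0 : ℂ) * τ + (g 1 1 : ℂ)) ^ 2 *
      wp τ (((a * g 1 1 : ℤ) : ℂ) / N) := by
  obtain ⟨m, hm⟩ := (ZMod.intCast_zmod_eq_zero_iff_dvd _ N).1 (CongruenceSubgroup.Gamma0_mem.1 hg)
  have hN' : (N : ℂ) ≠ 0 := by exact_mod_cast hN.ne'
  rw [wp_moebius g τ hτ, ← wp_add_lattice τ hτ (((a * g 1 1 : ℤ) : ℂ) / N) 0 (a * m)]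
  congr 2
  rw [hm]
  push_cast
  field_simp
  ring

lemma Wfun_moebius (N : ℕ) (hN : 0 < N) (g : SL(2, ℤ)) (hg : g ∈ CongruenceSubgroup.Gamma0 N)
    (τ : ℂ) (hτ : 0 < τ.im) (a₁ a₂ a₃ : ℤ) :
    Wfun N a₁ a₂ a₃ (moebius g τ) = Wfun N (a₁ * g 1 1) (a₂ * g 1 1) (a₃ * g 1 1) τ := by
  simp only [Wfun, wp_moebius_div N hN g hg τ hτ, ← mul_sub]
  exact mul_div_mul_left _ _ (pow_ne_zero 2 (moebius_denom_ne_zero g τ hτ))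

lemma Wfun_moebius_congr (N : ℕ) (hN : 0 < N) (g h : SL(2, ℤ))
    (hg : g ∈ CongruenceSubgroup.Gamma0 N) (hh : h ∈ CongruenceSubgroup.Gamma0 N)
    (hgh : ((g 1 1 : ℤ) : ZMod N) = (h 1 1 : ℤ) ∨ ((g 1 1 : ℤ) : ZMod N) = -(h 1 1 : ℤ))
    (τ : ℂ) (hτ : 0 < τ.im) (a₁ a₂ a₃ : ℤ) :
    Wfun N a₁ a₂ a₃ (moebius g τ) = Wfun N a₁ a₂ a₃ (moebius h τ) := by
  have key (a : ℤ) : wp τ (((a * g 1 1 : ℤ) : ℂ) / N) = wp τ (((a * h 1 1 : ℤ) : ℂ) / N) := by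
    rcases hgh with e | e
    · exact wp_div_congr N hN τ hτ _ _ (by push_cast; rw [e])
    · exact wp_div_congr_neg N hN τ hτ _ _ (by push_cast; rw [e, mul_neg])
  rw [Wfun_moebius N hN g hg τ hτ, Wfun_moebius N hN h hh τ hτ]
  simp only [Wfun, key]

lemma eq_or_eq_neg_of_mk_eq (N : ℕ) (u v : (ZMod N)ˣ)
    (h : (QuotientGroup.mk u : SNgroup N) = QuotientGroup.mk v) : u = v ∨ u = -v := by
  obtain ⟨k, hk⟩ := Subgroup.mem_closure_singleton.1 (QuotientGroup.eq.1 h.symm)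
  have hu : u = v * (-1) ^ k := by rw [hk, mul_inv_cancel_left]
  rcases Int.even_or_odd k with hk | hk
  · left; simpa [hk.neg_one_zpow] using hu
  · right; simpa [hk.neg_one_zpow] using hu

lemma Gamma0_apply_mul_apply_eq_one (N : ℕ) (g : SL(2, ℤ))
    (hg : g ∈ CongruenceSubgroup.Gamma0 N) :
    ((g 1 1 : ℤ) : ZMod N) * ((g 0 0 : ℤ) : ZMod N) = 1 := by
  have h := congrArg (Int.cast : ℤ → ZMod N) g.det_coe
  rw [Matrix.det_fin_two] at h
  push_cast at h
  rw [CongruenceSubgroup.Gamma0_mem.1 hg] at h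
  linear_combination h

/-- `T_{𝔄,F}` is invariant under `Γ₀(N)`. -/
theorem stmt8 (N : ℕ) (hN : 0 < N) {n : ℕ} (A : Fin n → ℤ × ℤ × ℤ)
    (hA : ∀ i, memE N (A i)) (F : MvPolynomial (Fin n) ℤ)
    (M : SNgroup N → SL(2, ℤ))
    (hM : ∀ s, M s ∈ CongruenceSubgroup.Gamma0 N ∧ IsDiagLift N (M s) s)
    (γ : SL(2, ℤ)) (hγ : γ ∈ CongruenceSubgroup.Gamma0 N) (τ : ℂ) (hτ : 0 < τ.im) :
    Tfun N A F M
        (((γ 0 0 : ℂ) * τ + (γ 0 1 : ℂ)) / ((γ 1 0 : ℂ) * τ + (γ 1 1 : ℂ)))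
      = Tfun N A F M τ := by
  have hτ' := moebius_im_pos γ τ hτ
  let d : (ZMod N)ˣ := Units.mkOfMulEqOne _ _ (Gamma0_apply_mul_apply_eq_one N γ hγ)
  let G (s : SNgroup N) : ℂ := MvPolynomial.aeval (fun i => Wfun N (A i).1 (A i).2.1 (A i).2.2
    (moebius ((M s : SL(2, ℤ)) : Matrix (Fin 2) (Fin 2) ℤ) τ)) F
  change Tfun N A F M (moebius γ τ) = ∑ᶠ s, G s
  rw [← finsum_comp_equiv (Equiv.mulRight (QuotientGroup.mk d : SNgroup N)), Tfun]
  refine finsum_congr fun s ↦ ?_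
  simp only [G, Equiv.coe_mulRight]
  congr 2
  funext i
  rw [← moebius_mul _ _ τ hτ]
  refine Wfun_moebius_congr N hN _ _ (mul_mem (hM s).1 hγ) (hM _).1 ?_ τ hτ _ _ _
  obtain ⟨u, hu, -, -, h10, h11⟩ := (hM s).2
  obtain ⟨v, hv, -, -, -, k11⟩ := (hM (s * QuotientGroup.mk d)).2
  have hprod : (((M s * γ) 1 1 : ℤ) : ZMod N) = ((u * d : (ZMod N)ˣ) : ZMod N) := by
    simp only [Matrix.SpecialLinearGroup.coe_mul, Matrix.mul_apply, Fin.sum_univ_two]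
    push_cast
    rw [h10, h11]
    simp [d]
  rw [hprod, k11]
  have huv : (QuotientGroup.mk (u * d) : SNgroup N) = QuotientGroup.mk v := by
    rw [hv, QuotientGroup.mk_mul, hu]
  rcases eq_or_eq_neg_of_mk_eq N _ _ huv with e | e
  · left; rw [e]
  · right; rw [e, Units.val_neg]
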